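/- arXiv:1212.6720 — 7 statements merged into one kernel-verified Lean document; each statement's English description precedes it below -/
import Mathlib

section
/- For any nested set H on a diagram D, n(H) = |V(D)| − |H|, where |H| is the number of elements of H and |V(D)| the number of vertices of D. -/
namespace DiagramStmt

variable {V : Type*} [Fintype V] [DecidableEq V]

/-- Two subdiagrams (identified with their vertex sets) are orthogonal:
their vertex sets are disjoint and no edge of `G` joins them. -/
def Orth (G : SimpleGraph V) (B₁ B₂ : Finset V) : Prop :=
  Disjoint B₁ B₂ ∧ ∀ i ∈ B₁, ∀ j ∈ B₂, ¬ G.Adj i j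

/-- Two subdiagrams are compatible if one contains the other or they are orthogonal. -/
def Compat (G : SimpleGraph V) (B₁ B₂ : Finset V) : Prop :=
  B₁ ⊆ B₂ ∨ B₂ ⊆ B₁ ∨ Orth G B₁ B₂

/-- A subdiagram is connected if its induced graph is connected. -/
def Conn (G : SimpleGraph V) (B : Finset V) : Prop :=
  (G.induce (↑B : Set V)).Connected

/-- `B` is a connected component of the subdiagram `D` of `G`: it is a maximal
connected subset of `D`. -/
def IsComponentOn (G : SimpleGraph V) (D B : Finset V) : Prop :=
  B ⊆ D ∧ Conn G B ∧ ∀ C, C ⊆ D → Conn G C → B ⊆ C → C = B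

/-- `H` is a nested set on the subdiagram `D` of `G`: a collection of pairwise
compatible connected subdiagrams of `D` containing all connected components of `D`. -/
def IsNestedSetOn (G : SimpleGraph V) (D : Finset V) (H : Finset (Finset V)) : Prop :=
  (∀ B ∈ H, B ⊆ D) ∧ (∀ B ∈ H, Conn G B) ∧
    (∀ B₁ ∈ H, ∀ B₂ ∈ H, Compat G B₁ B₂) ∧
    ∀ B, IsComponentOn G D B → B ∈ H

/-- A maximal nested set on `D`. -/
def IsMaxNestedSetOn (G : SimpleGraph V) (D : Finset V) (H : Finset (Finset V)) : Prop :=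
  IsNestedSetOn G D H ∧ ∀ H', IsNestedSetOn G D H' → H ⊆ H' → H' = H


open scoped Classical in
/-- `iH H B` is the union of the maximal elements of `H` properly contained in `B`. -/
noncomputable def iH (H : Finset (Finset V)) (B : Finset V) : Finset V :=
  (H.filter fun C => C ⊂ B ∧ ∀ C' ∈ H, C ⊂ C' → ¬ C' ⊂ B).biUnion id

theorem mem_iH_of_mem_of_ssubset {H : Finset (Finset V)} {B C : Finset V} (hC : C ∈ H)
    (hCB : C ⊂ B) {v : V} (hv : v ∈ C) : v ∈ iH H B := by
  classical
  obtain ⟨M, hCM, hM⟩ := (H.filter (· ⊂ B)).exists_le_maximal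
    (Finset.mem_filter.2 ⟨hC, hCB⟩)
  obtain ⟨hMH, hMB⟩ := Finset.mem_filter.1 hM.prop
  simp only [iH, Finset.mem_biUnion, Finset.mem_filter, id]
  exact ⟨M, ⟨hMH, hMB, fun C' hC' hMC' hC'B =>
    hM.not_gt (Finset.mem_filter.2 ⟨hC', hC'B⟩) hMC'⟩, hCM hv⟩

theorem exists_mem_ssubset_of_mem_iH {H : Finset (Finset V)} {B : Finset V} {v : V}
    (hv : v ∈ iH H B) : ∃ C ∈ H, C ⊂ B ∧ v ∈ C := by
  simp only [iH, Finset.mem_biUnion, Finset.mem_filter, id] at hv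
  obtain ⟨C, ⟨hC, hCB, -⟩, hvC⟩ := hv
  exact ⟨C, hC, hCB, hvC⟩

theorem exists_isComponentOn_mem (G : SimpleGraph V) {D : Finset V} {v : V} (hv : v ∈ D) :
    ∃ B, IsComponentOn G D B ∧ v ∈ B := by
  classical
  have hconn : Conn G {v} := by
    rw [Conn, Finset.coe_singleton]
    exact SimpleGraph.Connected.of_subsingleton
  obtain ⟨M, hvM, hM⟩ := (D.powerset.filter (Conn G)).exists_le_maximal
    (Finset.mem_filter.2 ⟨Finset.mem_powerset.2 (Finset.singleton_subset_iff.2 hv), hconn⟩)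
  obtain ⟨hMD, hMc⟩ := Finset.mem_filter.1 hM.prop
  exact ⟨M, ⟨Finset.mem_powerset.1 hMD, hMc, fun C hCD hC hMC =>
    (hM.eq_of_le (Finset.mem_filter.2 ⟨Finset.mem_powerset.2 hCD, hC⟩) hMC).symm⟩,
    Finset.singleton_subset_iff.1 hvM⟩

theorem pairwiseDisjoint_sdiff_iH {G : SimpleGraph V} {D : Finset V} {H : Finset (Finset V)}
    (hH : IsNestedSetOn G D H) :
    (H : Set (Finset V)).PairwiseDisjoint fun B => B \ iH H B := by
  intro B₁ h₁ B₂ h₂ hne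
  refine Finset.disjoint_left.2 fun v hv₁ hv₂ => ?_
  rw [Finset.mem_sdiff] at hv₁ hv₂
  rcases hH.2.2.1 B₁ h₁ B₂ h₂ with h | h | h
  · exact hv₂.2 (mem_iH_of_mem_of_ssubset h₁ (h.ssubset_of_ne hne) hv₁.1)
  · exact hv₁.2 (mem_iH_of_mem_of_ssubset h₂ (h.ssubset_of_ne hne.symm) hv₂.1)
  · exact Finset.disjoint_left.1 h.1 hv₁.1 hv₂.1

theorem biUnion_sdiff_iH {G : SimpleGraph V} {D : Finset V} {H : Finset (Finset V)}
    (hH : IsNestedSetOn G D H) : (H.biUnion fun B => B \ iH H B) = D := by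
  refine Finset.Subset.antisymm
    (Finset.biUnion_subset.2 fun B hB => Finset.sdiff_subset.trans (hH.1 B hB)) fun v hv => ?_
  obtain ⟨B, hB, hvB⟩ := exists_isComponentOn_mem G hv
  obtain ⟨M, -, hM⟩ := (H.filter (v ∈ ·)).exists_le_minimal
    (Finset.mem_filter.2 ⟨hH.2.2.2 B hB, hvB⟩)
  obtain ⟨hMH, hvM⟩ := Finset.mem_filter.1 hM.prop
  refine Finset.mem_biUnion.2 ⟨M, hMH, Finset.mem_sdiff.2 ⟨hvM, fun hv => ?_⟩⟩
  obtain ⟨C, hC, hCM, hvC⟩ := exists_mem_ssubset_of_mem_iH hv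
  exact hM.not_lt (Finset.mem_filter.2 ⟨hC, hvC⟩) hCM

/-- for any nested set `H` on `D`,
`n(H) = Σ_{B ∈ H} (n(B;H) − 1) = |V(D)| − |H|`, where `n(B;H) = |B ∖ i_H(B)|`. -/
theorem nestedSet_rank_formula (G : SimpleGraph V) (H : Finset (Finset V))
    (hH : IsNestedSetOn G Finset.univ H) :
    (∑ B ∈ H, (((B \ iH H B).card : ℤ) - 1)) = (Fintype.card V : ℤ) - H.card := by
  rw [Finset.sum_sub_distrib, ← Nat.cast_sum,
    ← Finset.card_biUnion (pairwiseDisjoint_sdiff_iH hH), biUnion_sdiff_iH hH]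
  simp

end DiagramStmt
end

section
/- A nested set H on a diagram D is a maximal nested set if and only if n(B;H) = 1 for every B ∈ H. -/
namespace DiagramStmt

variable {V : Type*} [Fintype V] [DecidableEq V]

section

variable {W : Type*} {G : SimpleGraph W} {B C : Finset W} {H : Finset (Finset W)}

theorem mem_iH [Fintype W] [DecidableEq W] {x : W} : x ∈ iH H B ↔ ∃ C ∈ H, C ⊂ B ∧ x ∈ C := by
  classical
  simp only [iH, Finset.mem_biUnion, Finset.mem_filter, id]
  constructor
  · rintro ⟨C, ⟨hC, hCB, -⟩, hx⟩
    exact ⟨C, hC, hCB, hx⟩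
  · rintro ⟨C, hC, hCB, hx⟩
    obtain ⟨M, hCM, hM⟩ :=
      (H.filter (· ⊂ B)).exists_le_maximal (Finset.mem_filter.2 ⟨hC, hCB⟩)
    have hMH := Finset.mem_filter.1 hM.prop
    exact ⟨M, ⟨hMH.1, hMH.2, fun C' hC' hlt hC'B =>
      hM.not_gt (Finset.mem_filter.2 ⟨hC', hC'B⟩) hlt⟩, hCM hx⟩

theorem Conn.nonempty (hB : Conn G B) : B.Nonempty := by
  obtain ⟨x⟩ := SimpleGraph.Connected.nonempty hB
  exact ⟨x, x.2⟩

theorem conn_singleton (x : W) : Conn G {x} := by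
  unfold Conn
  rw [Finset.coe_singleton]
  have : Nonempty ({x} : Set W) := ⟨⟨x, rfl⟩⟩
  exact ⟨.of_subsingleton⟩

theorem Conn.union [DecidableEq W] (hB : Conn G B) (hC : Conn G C) (h : ¬ Orth G B C) : Conn G (B ∪ C) := by
  unfold Conn
  rw [Finset.coe_union]
  by_cases hd : Disjoint B C
  · simp only [Orth, hd, true_and, not_forall, not_not] at h
    obtain ⟨i, hi, j, hj, hij⟩ := h
    exact SimpleGraph.connected_induce_union hB.preconnected hC.preconnected hi hj hij
  · obtain ⟨x, hx, hx'⟩ := Finset.not_disjoint_iff.1 hd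
    exact G.induce_union_connected hB.preconnected hC.preconnected ⟨x, hx, hx'⟩

/-- A proper nonempty part of a connected subdiagram is joined by an edge to its complement. -/
theorem Conn.exists_adj (hB : Conn G B) (hC : C.Nonempty) (hCB : C ⊂ B) :
    ∃ i ∈ C, ∃ j ∈ B, j ∉ C ∧ G.Adj i j := by
  obtain ⟨u, hu⟩ := hC
  obtain ⟨v, hv, hvC⟩ := Finset.exists_of_ssubset hCB
  obtain ⟨p⟩ := hB.preconnected ⟨u, hCB.1 hu⟩ ⟨v, hv⟩
  obtain ⟨d, -, hd₁, hd₂⟩ := p.exists_boundary_dart {z | (z : W) ∈ C} hu hvC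
  exact ⟨d.fst, hd₁, d.snd, d.snd.2, hd₂, d.adj⟩

/-- Every connected subdiagram of `D` lies in a connected component of `D`. -/
theorem Conn.exists_isComponentOn {D : Finset W} (hC : Conn G C) (hCD : C ⊆ D) :
    ∃ B, IsComponentOn G D B ∧ C ⊆ B := by
  classical
  obtain ⟨B, hCB, hB⟩ :=
    (D.powerset.filter (Conn G)).exists_le_maximal
      (Finset.mem_filter.2 ⟨Finset.mem_powerset.2 hCD, hC⟩)
  have hB' := Finset.mem_filter.1 hB.prop
  exact ⟨B, ⟨Finset.mem_powerset.1 hB'.1, hB'.2, fun E hE hEc hBE =>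
    (hB.eq_of_le (Finset.mem_filter.2 ⟨Finset.mem_powerset.2 hE, hEc⟩) hBE).symm⟩, hCB⟩

theorem Orth.symm (h : Orth G B C) : Orth G C B :=
  ⟨h.1.symm, fun i hi j hj hij => h.2 j hj i hi hij.symm⟩

theorem Compat.symm (h : Compat G B C) : Compat G C B := by
  rcases h with h | h | h
  exacts [.inr (.inl h), .inl h, .inr (.inr h.symm)]

/-- A connected component of a subdiagram is compatible with every connected part of it. -/
theorem IsComponentOn.compat [DecidableEq W] {D : Finset W} (hC : IsComponentOn G D C) (hB : Conn G B)
    (hBD : B ⊆ D) : Compat G B C := by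
  by_cases h : Orth G B C
  · exact .inr (.inr h)
  · refine .inl ?_
    rw [← hC.2.2 (B ∪ C) (Finset.union_subset hBD hC.1) (hB.union hC.2.1 h)
      Finset.subset_union_right]
    exact Finset.subset_union_left

/-- A connected subdiagram is never the union of pairwise compatible proper parts. -/
theorem Conn.sdiff_iH_nonempty [Fintype W] [DecidableEq W] (hB : Conn G B)
    (hH : ∀ B₁ ∈ H, ∀ B₂ ∈ H, Compat G B₁ B₂) (hne : ∀ C ∈ H, C.Nonempty) :
    (B \ iH H B).Nonempty := by
  classical
  rw [Finset.sdiff_nonempty]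
  intro hsub
  obtain ⟨b, hb⟩ := hB.nonempty
  obtain ⟨C₀, hC₀, hC₀B, -⟩ := mem_iH.1 (hsub hb)
  obtain ⟨M, -, hM⟩ :=
    (H.filter (· ⊂ B)).exists_le_maximal (Finset.mem_filter.2 ⟨hC₀, hC₀B⟩)
  obtain ⟨hMH, hMB⟩ := Finset.mem_filter.1 hM.prop
  obtain ⟨i, hi, j, hj, hjM, hij⟩ := hB.exists_adj (hne M hMH) hMB
  obtain ⟨C, hC, hCB, hjC⟩ := mem_iH.1 (hsub hj)
  rcases hH M hMH C hC with h | h | h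
  · exact hjM (hM.le_of_ge (Finset.mem_filter.2 ⟨hC, hCB⟩) h hjC)
  · exact hjM (h hjC)
  · exact h.2 i hi j hjC hij

theorem IsNestedSetOn.sdiff_iH_nonempty [Fintype W] [DecidableEq W] {D : Finset W} (hH : IsNestedSetOn G D H)
    (hB : B ∈ H) : (B \ iH H B).Nonempty :=
  (hH.2.1 B hB).sdiff_iH_nonempty hH.2.2.1 fun C hC => (hH.2.1 C hC).nonempty

theorem IsNestedSetOn.insert [DecidableEq W] {D : Finset W} (hH : IsNestedSetOn G D H) (hCD : C ⊆ D)
    (hC : Conn G C) (hcompat : ∀ B ∈ H, Compat G B C) :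
    IsNestedSetOn G D (insert C H) := by
  refine ⟨?_, ?_, ?_, fun E hE => Finset.mem_insert_of_mem (hH.2.2.2 E hE)⟩
  · simpa [hCD] using hH.1
  · simpa [hC] using hH.2.1
  · intro B₁ h₁ B₂ h₂
    rcases Finset.mem_insert.1 h₁ with e₁ | h₁ <;> rcases Finset.mem_insert.1 h₂ with e₂ | h₂
    · exact .inl (e₁.trans e₂.symm).subset
    · exact e₁ ▸ (hcompat _ h₂).symm
    · exact e₂ ▸ hcompat _ h₁
    · exact hH.2.2.1 _ h₁ _ h₂

theorem IsMaxNestedSetOn.card_sdiff_iH [Fintype W] [DecidableEq W] {D : Finset W} (hH : IsMaxNestedSetOn G D H)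
    (hB : B ∈ H) : (B \ iH H B).card = 1 := by
  classical
  obtain ⟨hN, hmax⟩ := hH
  refine le_antisymm ?_ (Finset.card_pos.2 (hN.sdiff_iH_nonempty hB))
  refine Finset.card_le_one.2 fun x hx y hy => ?_
  by_contra hxy
  rw [Finset.mem_sdiff] at hx hy
  obtain ⟨C, hC, hyC⟩ := (conn_singleton (G := G) y).exists_isComponentOn (D := B.erase x)
    (Finset.singleton_subset_iff.2 (Finset.mem_erase.2 ⟨Ne.symm hxy, hy.1⟩))
  have hCB : C ⊂ B := hC.1.trans_ssubset (Finset.erase_ssubset hx.1)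
  have hCH : C ∉ H := fun h =>
    hy.2 (mem_iH.2 ⟨C, h, hCB, Finset.singleton_subset_iff.1 hyC⟩)
  refine hCH (hmax _ (hN.insert (hCB.1.trans (hN.1 B hB)) hC.2.1 fun E hE => ?_)
    (Finset.subset_insert C H) ▸ Finset.mem_insert_self C H)
  rcases hN.2.2.1 E hE B hB with h | h | h
  · rcases h.eq_or_ssubset with rfl | h
    · exact .inr (.inl hCB.1)
    · exact hC.compat (hN.2.1 E hE) (Finset.subset_erase.2
        ⟨h.1, fun hxE => hx.2 (mem_iH.2 ⟨E, hE, h, hxE⟩)⟩)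
  · exact .inr (.inl (hCB.1.trans h))
  · exact .inr (.inr ⟨h.1.mono_right hCB.1, fun i hi j hj => h.2 i hi j (hCB.1 hj)⟩)

theorem IsNestedSetOn.isMaxNestedSetOn [Fintype W] [DecidableEq W] {D : Finset W} (hH : IsNestedSetOn G D H)
    (hcard : ∀ B ∈ H, (B \ iH H B).card = 1) : IsMaxNestedSetOn G D H := by
  classical
  refine ⟨hH, fun H' hH' hsub => subset_antisymm (fun C hC => ?_) hsub⟩
  have hCc := hH'.2.1 C hC
  obtain ⟨K, hK, hCK⟩ := hCc.exists_isComponentOn (hH'.1 C hC)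
  obtain ⟨B, -, hBmin⟩ :=
    (H.filter (C ⊆ ·)).exists_le_minimal (Finset.mem_filter.2 ⟨hH.2.2.2 K hK, hCK⟩)
  obtain ⟨hB, hCB⟩ := Finset.mem_filter.1 hBmin.prop
  rcases hCB.eq_or_ssubset with rfl | hCB
  · exact hB
  have hparts : ∀ E ∈ H, E ⊂ B → E ⊆ C ∨ Orth G C E := fun E hE hEB =>
    (hH'.2.2.1 C hC E (hsub hE)).resolve_left fun h =>
      hBmin.not_lt (Finset.mem_filter.2 ⟨hE, h⟩) hEB
  obtain ⟨x, hx⟩ := Finset.card_eq_one.1 (hcard B hB)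
  have hmem : ∀ z ∈ B, z ≠ x → z ∈ iH H B := fun z hz hzx => by
    by_contra h
    exact hzx (Finset.mem_singleton.1 (hx ▸ Finset.mem_sdiff.2 ⟨hz, h⟩))
  by_contra hCH
  by_cases hxC : x ∈ C
  · obtain ⟨i, hi, j, hj, hjC, hij⟩ := (hH.2.1 B hB).exists_adj hCc.nonempty hCB
    obtain ⟨E, hE, hEB, hjE⟩ := mem_iH.1 (hmem j hj fun h => hjC (h ▸ hxC))
    rcases hparts E hE hEB with h | h
    · exact hjC (h hjE)
    · exact h.2 i hi j hjE hij
  · refine Finset.sdiff_nonempty.1 (hH'.sdiff_iH_nonempty hC) fun c hc => ?_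
    obtain ⟨E, hE, hEB, hcE⟩ := mem_iH.1 (hmem c (hCB.1 hc) fun h => hxC (h ▸ hc))
    rcases hparts E hE hEB with h | h
    · exact mem_iH.2 ⟨E, hsub hE, h.ssubset_of_ne fun h => hCH (h ▸ hE), hcE⟩
    · exact absurd hcE (Finset.disjoint_left.1 h.1 hc)

end

/-- a nested set `H` on `D` is maximal if and only if `n(B;H) = 1`
for every `B ∈ H`, where `n(B;H) = |B ∖ i_H(B)|`. -/
theorem maxNestedSet_iff_n_eq_one (G : SimpleGraph V) (H : Finset (Finset V))
    (hH : IsNestedSetOn G Finset.univ H) :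
    IsMaxNestedSetOn G Finset.univ H ↔ ∀ B ∈ H, (B \ iH H B).card = 1 :=
  ⟨fun h _ hB => h.card_sdiff_iH hB, hH.isMaxNestedSetOn⟩

end DiagramStmt
end

section
/- Let i : (g_D, g_{D,−}, g_{D,+}) → (g, g₋, g₊) be an embedding of finite-dimensional Manin triples over a field k of characteristic zero. Then there exist unique linear maps p₊ : g₊ → g_{D,+} and p₋ : g₋ → g_{D,−} satisfying ⟨p_±(x), y⟩_D = ⟨x, i(y)⟩ for all x ∈ g_± and y ∈ g_{D,∓}; they satisfy p_± ∘ (i restricted to g_{D,±}) = id, ker p_± = m_± := g_± ∩ i(g_D)^⊥, and g_± = i(g_{D,±}) ⊕ m_± as vector spaces. -/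
namespace ManinStmt

/-- A (finite-dimensional) Manin triple: a Lie algebra `g` with a nondegenerate
symmetric invariant bilinear form and two isotropic Lie subalgebras `plus`,
`minus` with `g = minus ⊕ plus` as vector spaces. -/
structure ManinTriple (k g : Type*) [Field k] [LieRing g] [LieAlgebra k g] where
  form : g →ₗ[k] g →ₗ[k] k
  nondeg : ∀ x : g, (∀ y : g, form x y = 0) → x = 0
  symm : ∀ x y : g, form x y = form y x
  invariant : ∀ x y z : g, form ⁅x, y⁆ z = form x ⁅y, z⁆
  plus : LieSubalgebra k g
  minus : LieSubalgebra k g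
  isotropic_plus : ∀ x ∈ plus, ∀ y ∈ plus, form x y = 0
  isotropic_minus : ∀ x ∈ minus, ∀ y ∈ minus, form x y = 0
  compl : IsCompl minus.toSubmodule plus.toSubmodule

variable {k gD g : Type*} [Field k]
  [LieRing gD] [LieAlgebra k gD] [LieRing g] [LieAlgebra k g]

/-- An embedding of Manin triples: an injective, form-preserving Lie algebra
morphism mapping `plus` into `plus` and `minus` into `minus`. -/
structure IsManinEmbedding (TD : ManinTriple k gD) (T : ManinTriple k g)
    (i : gD →ₗ⁅k⁆ g) : Prop where
  inj : Function.Injective i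
  form_eq : ∀ x y : gD, T.form (i x) (i y) = TD.form x y
  maps_plus : ∀ x ∈ TD.plus, i x ∈ T.plus
  maps_minus : ∀ x ∈ TD.minus, i x ∈ T.minus

/-- The orthogonal complement of `i(gD)` in `g` with respect to the form of `T`. -/
def perpD (T : ManinTriple k g) (i : gD →ₗ⁅k⁆ g) : Submodule k g where
  carrier := {x | ∀ d : gD, T.form x (i d) = 0}
  add_mem' := fun {a b} ha hb d => by
    rw [map_add, LinearMap.add_apply, ha d, hb d, add_zero]
  zero_mem' := fun d => by simp
  smul_mem' := fun c x hx d => by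
    rw [map_smul, LinearMap.smul_apply, hx d, smul_zero]

/-- `m₊ = g₊ ∩ i(gD)^⊥`. -/
def mPlus (T : ManinTriple k g) (i : gD →ₗ⁅k⁆ g) : Submodule k g :=
  T.plus.toSubmodule ⊓ perpD T i

/-- `m₋ = g₋ ∩ i(gD)^⊥`. -/
def mMinus (T : ManinTriple k g) (i : gD →ₗ⁅k⁆ g) : Submodule k g :=
  T.minus.toSubmodule ⊓ perpD T i

/-- The embedding is split if `m₊` and `m₋` are Lie subalgebras of `g`. -/
def IsSplit (T : ManinTriple k g) (i : gD →ₗ⁅k⁆ g) : Prop :=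
  (∀ x ∈ mPlus T i, ∀ y ∈ mPlus T i, ⁅x, y⁆ ∈ mPlus T i) ∧
  (∀ x ∈ mMinus T i, ∀ y ∈ mMinus T i, ⁅x, y⁆ ∈ mMinus T i)


/-- Exchanging the two halves of a Manin triple. -/
def ManinTriple.swap (T : ManinTriple k g) : ManinTriple k g where
  form := T.form
  nondeg := T.nondeg
  symm := T.symm
  invariant := T.invariant
  plus := T.minus
  minus := T.plus
  isotropic_plus := T.isotropic_minus
  isotropic_minus := T.isotropic_plus
  compl := T.compl.symm

theorem IsManinEmbedding.swap {TD : ManinTriple k gD} {T : ManinTriple k g}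
    {i : gD →ₗ⁅k⁆ g} (hi : IsManinEmbedding TD T i) :
    IsManinEmbedding TD.swap T.swap i where
  inj := hi.inj
  form_eq := hi.form_eq
  maps_plus := hi.maps_minus
  maps_minus := hi.maps_plus

theorem ManinTriple.exists_add (T : ManinTriple k g) (x : g) :
    ∃ a ∈ T.minus, ∃ b ∈ T.plus, a + b = x :=
  Submodule.mem_sup.1 (T.compl.sup_eq_top ▸ Submodule.mem_top)

theorem ManinTriple.eq_zero_of_forall (T : ManinTriple k g) {x : g}
    (hp : ∀ y ∈ T.plus, T.form x y = 0) (hm : ∀ y ∈ T.minus, T.form x y = 0) : x = 0 := by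
  refine T.nondeg x fun y => ?_
  obtain ⟨a, ha, b, hb, rfl⟩ := T.exists_add y
  rw [map_add, hm a ha, hp b hb, add_zero]

theorem ManinTriple.mem_plus_of_forall (T : ManinTriple k g) {x : g}
    (h : ∀ y ∈ T.plus, T.form x y = 0) : x ∈ T.plus := by
  obtain ⟨a, ha, b, hb, rfl⟩ := T.exists_add x
  have ha0 : a = 0 := T.eq_zero_of_forall
    (fun y hy => by simpa [T.isotropic_plus b hb y hy] using h y hy)
    (fun y hy => T.isotropic_minus a ha y hy)
  rwa [ha0, zero_add]

theorem ManinTriple.eq_of_forall_minus (T : ManinTriple k g) {x y : T.plus}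
    (h : ∀ z : T.minus, T.form x z = T.form y z) : x = y := by
  refine Subtype.ext (sub_eq_zero.1 (T.eq_zero_of_forall (fun z hz => ?_) fun z hz => ?_))
  · rw [map_sub, LinearMap.sub_apply, T.isotropic_plus x x.2 z hz,
      T.isotropic_plus y y.2 z hz, sub_zero]
  · rw [map_sub, LinearMap.sub_apply, h ⟨z, hz⟩, sub_self]

/-- The adjoint of a linear map into a Manin triple exists. -/
theorem ManinTriple.exists_adjoint [FiniteDimensional k gD] (TD : ManinTriple k gD)
    (T : ManinTriple k g) (i : gD →ₗ[k] g) :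
    ∃ q : g →ₗ[k] gD, ∀ x y, TD.form (q x) y = T.form x (i y) := by
  have hinj : Function.Injective TD.form := by
    refine (injective_iff_map_eq_zero _).2 fun x hx => TD.nondeg x fun y => ?_
    rw [hx, LinearMap.zero_apply]
  let e : gD ≃ₗ[k] Module.Dual k gD :=
    LinearEquiv.ofInjectiveOfFinrankEq TD.form hinj Subspace.dual_finrank_eq.symm
  have he : ∀ f, TD.form (e.symm f) = f := fun f => e.apply_symm_apply f
  refine ⟨e.symm.toLinearMap ∘ₗ (LinearMap.lcomp k k i) ∘ₗ T.form, fun x y => ?_⟩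
  exact LinearMap.congr_fun (he _) y

theorem IsManinEmbedding.existsUnique_projection [FiniteDimensional k gD]
    {TD : ManinTriple k gD} {T : ManinTriple k g} {i : gD →ₗ⁅k⁆ g}
    (hi : IsManinEmbedding TD T i) :
    ∃! p : T.plus →ₗ[k] TD.plus,
      ∀ (x : T.plus) (y : TD.minus), TD.form (p x) y = T.form x (i y) := by
  obtain ⟨q, hq⟩ := TD.exists_adjoint T i.toLinearMap
  have hmem : ∀ x : T.plus, q x ∈ TD.plus.toSubmodule := fun x =>
    TD.mem_plus_of_forall fun y hy =>
      (hq x y).trans (T.isotropic_plus x x.2 _ (hi.maps_plus y hy))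
  refine ⟨(q ∘ₗ T.plus.toSubmodule.subtype).codRestrict TD.plus.toSubmodule hmem,
    fun x y => hq x y, fun p hp => LinearMap.ext fun x => ?_⟩
  exact TD.eq_of_forall_minus fun z => (hp x z).trans (hq x z).symm

theorem IsManinEmbedding.projection_properties
    {TD : ManinTriple k gD} {T : ManinTriple k g} {i : gD →ₗ⁅k⁆ g}
    (hi : IsManinEmbedding TD T i) (p : T.plus →ₗ[k] TD.plus)
    (hp : ∀ (x : T.plus) (y : TD.minus), TD.form (p x) y = T.form x (i y)) :
    (∀ d : TD.plus, p ⟨i d, hi.maps_plus _ d.2⟩ = d) ∧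
    (∀ x : T.plus, p x = 0 ↔ (x : g) ∈ perpD T i) ∧
    Disjoint (TD.plus.toSubmodule.map i.toLinearMap) (mPlus T i) ∧
    TD.plus.toSubmodule.map i.toLinearMap ⊔ mPlus T i = T.plus.toSubmodule := by
  have hid : ∀ d : TD.plus, p ⟨i d, hi.maps_plus _ d.2⟩ = d := fun d =>
    TD.eq_of_forall_minus fun z => (hp _ z).trans (hi.form_eq d z)
  have hker : ∀ x : T.plus, p x = 0 ↔ (x : g) ∈ perpD T i := by
    intro x
    refine ⟨fun hx d => ?_, fun hx => TD.eq_of_forall_minus fun z => ?_⟩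
    · obtain ⟨a, ha, b, hb, rfl⟩ := TD.exists_add d
      have h := hp x ⟨a, ha⟩
      rw [hx] at h
      rw [map_add, map_add, ← h, T.isotropic_plus x x.2 _ (hi.maps_plus b hb)]
      simp
    · rw [hp x z, hx z]
      simp
  refine ⟨hid, hker, ?_, le_antisymm (sup_le ?_ inf_le_left) fun x hx => ?_⟩
  · rw [Submodule.disjoint_def]
    rintro _ ⟨d, hd, rfl⟩ hm
    have h := (hker ⟨i d, hi.maps_plus d hd⟩).2 hm.2
    rw [hid ⟨d, hd⟩] at h
    have h0 : d = 0 := congrArg Subtype.val h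
    rw [h0, map_zero]
  · rintro _ ⟨d, hd, rfl⟩
    exact hi.maps_plus d hd
  · let x' : T.plus := ⟨x, hx⟩
    let y : T.plus := ⟨i (p x'), hi.maps_plus _ (p x').2⟩
    have hy : p (x' - y) = 0 := by rw [map_sub, hid, sub_self]
    exact Submodule.mem_sup.2 ⟨y, ⟨p x', (p x').2, rfl⟩, x - y,
      ⟨(x' - y).2, (hker _).1 hy⟩, add_sub_cancel _ _⟩

/-- existence and uniqueness of the projections `p₊ : g₊ → g_{D,+}`,
`p₋ : g₋ → g_{D,−}` adjoint to the embedding `i`, together with `p_± ∘ i = id`,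
`ker p_± = m_±`, and `g_± = i(g_{D,±}) ⊕ m_±`. -/
theorem projections_of_manin_embedding [CharZero k]
    [FiniteDimensional k gD] [FiniteDimensional k g]
    (TD : ManinTriple k gD) (T : ManinTriple k g)
    (i : gD →ₗ⁅k⁆ g) (hi : IsManinEmbedding TD T i) :
    (∃! p : ↥T.plus →ₗ[k] ↥TD.plus,
        ∀ (x : ↥T.plus) (y : ↥TD.minus),
          TD.form ↑(p x) ↑y = T.form ↑x (i ↑y)) ∧
    (∃! p : ↥T.minus →ₗ[k] ↥TD.minus,
        ∀ (x : ↥T.minus) (y : ↥TD.plus),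
          TD.form ↑(p x) ↑y = T.form ↑x (i ↑y)) ∧
    (∀ p : ↥T.plus →ₗ[k] ↥TD.plus,
        (∀ (x : ↥T.plus) (y : ↥TD.minus),
          TD.form ↑(p x) ↑y = T.form ↑x (i ↑y)) →
        (∀ d : ↥TD.plus, p ⟨i ↑d, hi.maps_plus _ d.2⟩ = d) ∧
        (∀ x : ↥T.plus, p x = 0 ↔ (x : g) ∈ perpD T i) ∧
        Disjoint (TD.plus.toSubmodule.map i.toLinearMap) (mPlus T i) ∧
        TD.plus.toSubmodule.map i.toLinearMap ⊔ mPlus T i = T.plus.toSubmodule) ∧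
    (∀ p : ↥T.minus →ₗ[k] ↥TD.minus,
        (∀ (x : ↥T.minus) (y : ↥TD.plus),
          TD.form ↑(p x) ↑y = T.form ↑x (i ↑y)) →
        (∀ d : ↥TD.minus, p ⟨i ↑d, hi.maps_minus _ d.2⟩ = d) ∧
        (∀ x : ↥T.minus, p x = 0 ↔ (x : g) ∈ perpD T i) ∧
        Disjoint (TD.minus.toSubmodule.map i.toLinearMap) (mMinus T i) ∧
        TD.minus.toSubmodule.map i.toLinearMap ⊔ mMinus T i = T.minus.toSubmodule) := by
  exact ⟨hi.existsUnique_projection, hi.swap.existsUnique_projection,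
    hi.projection_properties, hi.swap.projection_properties⟩

end ManinStmt
end

section
/- Let i : (g_D, g_{D,−}, g_{D,+}) → (g, g₋, g₊) be a split embedding of finite-dimensional Manin triples over a field k of characteristic zero. Then [i(g_D), m_±] ⊆ m_± where m_± := g_± ∩ i(g_D)^⊥; consequently the subspaces p_± := m_± ⊕ i(g_D) are Lie subalgebras of g. -/
namespace ManinStmt

variable {k gD g : Type*} [Field k]
  [LieRing gD] [LieAlgebra k gD] [LieRing g] [LieAlgebra k g]

/-- The subalgebra `plus` contains its own orthogonal complement. -/
theorem ManinTriple.mem_plus_of_orthogonal (T : ManinTriple k g) {x : g}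
    (hx : ∀ y ∈ T.plus, T.form x y = 0) : x ∈ T.plus := by
  have decomp (z : g) : ∃ u ∈ T.minus, ∃ v ∈ T.plus, u + v = z := by
    have hz : z ∈ T.minus.toSubmodule ⊔ T.plus.toSubmodule := by
      rw [T.compl.sup_eq_top]
      trivial
    exact Submodule.mem_sup.1 hz
  obtain ⟨u, hu, v, hv, rfl⟩ := decomp x
  have hu0 : u = 0 := by
    refine T.nondeg u fun z => ?_
    obtain ⟨a, ha, b, hb, rfl⟩ := decomp z
    have hb0 := hx b hb
    rw [map_add, LinearMap.add_apply, T.isotropic_plus v hv b hb, add_zero] at hb0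
    rw [map_add, T.isotropic_minus u hu a ha, hb0, add_zero]
  rwa [hu0, zero_add]

/-- Every linear functional is represented by the form. -/
theorem ManinTriple.form_surjective [FiniteDimensional k g] (T : ManinTriple k g) :
    Function.Surjective T.form := by
  refine (LinearMap.injective_iff_surjective_of_finrank_eq_finrank
    (Subspace.dual_finrank_eq (K := k) (V := g)).symm).1 ?_
  refine (injective_iff_map_eq_zero T.form).2 fun x hx => T.nondeg x fun y => ?_
  rw [hx, LinearMap.zero_apply]

/-- `plus` is spanned by the image of `TD.plus` and `mPlus`. -/
theorem IsManinEmbedding.exists_sub_mem_mPlus [FiniteDimensional k gD]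
    {TD : ManinTriple k gD} {T : ManinTriple k g} {i : gD →ₗ⁅k⁆ g}
    (hi : IsManinEmbedding TD T i) {z : g} (hz : z ∈ T.plus) :
    ∃ e ∈ TD.plus, z - i e ∈ mPlus T i := by
  obtain ⟨e, he⟩ := TD.form_surjective ((T.form z).comp i.toLinearMap)
  have he' (d : gD) : TD.form e d = T.form z (i d) := LinearMap.congr_fun he d
  have hep : e ∈ TD.plus := TD.mem_plus_of_orthogonal fun d hd => by
    rw [he', T.isotropic_plus z hz _ (hi.maps_plus d hd)]
  refine ⟨e, hep, sub_mem hz (hi.maps_plus e hep), fun d => ?_⟩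
  rw [map_sub, LinearMap.sub_apply, hi.form_eq, he', sub_self]

theorem lie_mem_perpD (T : ManinTriple k g) (i : gD →ₗ⁅k⁆ g) (d : gD) {y : g}
    (hy : y ∈ perpD T i) : ⁅i d, y⁆ ∈ perpD T i := fun e => by
  rw [← lie_skew, map_neg, LinearMap.neg_apply, T.invariant, ← LieHom.map_lie, hy, neg_zero]

theorem IsManinEmbedding.lie_mem_mPlus [FiniteDimensional k gD]
    {TD : ManinTriple k gD} {T : ManinTriple k g} {i : gD →ₗ⁅k⁆ g}
    (hi : IsManinEmbedding TD T i)
    (hm : ∀ x ∈ mPlus T i, ∀ y ∈ mPlus T i, ⁅x, y⁆ ∈ mPlus T i)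
    (d : gD) {y : g} (hy : y ∈ mPlus T i) : ⁅i d, y⁆ ∈ mPlus T i := by
  have hperp := lie_mem_perpD T i d hy.2
  refine ⟨T.mem_plus_of_orthogonal fun z hz => ?_, hperp⟩
  obtain ⟨e, -, he⟩ := hi.exists_sub_mem_mPlus hz
  rw [← sub_add_cancel z (i e), map_add, hperp e, add_zero, T.invariant, T.symm]
  exact (hm y hy _ he).2 d

/-- A Lie-closed subspace normalized by the range of a Lie algebra morphism spans, together
with that range, a Lie-closed subspace. -/
theorem lie_mem_sup_range (i : gD →ₗ⁅k⁆ g) {m : Submodule k g}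
    (hm : ∀ x ∈ m, ∀ y ∈ m, ⁅x, y⁆ ∈ m) (hi : ∀ d : gD, ∀ y ∈ m, ⁅i d, y⁆ ∈ m) :
    ∀ x ∈ m ⊔ LinearMap.range i.toLinearMap, ∀ y ∈ m ⊔ LinearMap.range i.toLinearMap,
      ⁅x, y⁆ ∈ m ⊔ LinearMap.range i.toLinearMap := by
  intro x hx y hy
  obtain ⟨a, ha, _, ⟨d, rfl⟩, rfl⟩ := Submodule.mem_sup.1 hx
  obtain ⟨b, hb, _, ⟨e, rfl⟩, rfl⟩ := Submodule.mem_sup.1 hy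
  have hae : ⁅a, i e⁆ ∈ m := by
    rw [← lie_skew]
    exact neg_mem (hi e a ha)
  refine Submodule.mem_sup.2 ⟨⁅a, b⁆ + ⁅a, i e⁆ + ⁅i d, b⁆,
    add_mem (add_mem (hm a ha b hb) hae) (hi d b hb), i ⁅d, e⁆, ⟨⁅d, e⁆, rfl⟩, ?_⟩
  simp only [LieHom.coe_toLinearMap, LieHom.map_lie, add_lie, lie_add]
  abel

/-- for a split embedding of Manin triples, `[i(g_D), m_±] ⊆ m_±`;
consequently the subspaces `p_± = m_± ⊕ i(g_D)` are Lie subalgebras of `g`. -/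
theorem parabolic_subalgebras [CharZero k]
    [FiniteDimensional k gD] [FiniteDimensional k g]
    (TD : ManinTriple k gD) (T : ManinTriple k g)
    (i : gD →ₗ⁅k⁆ g) (hi : IsManinEmbedding TD T i) (hsplit : IsSplit T i) :
    (∀ d : gD, ∀ y ∈ mPlus T i, ⁅i d, y⁆ ∈ mPlus T i) ∧
    (∀ d : gD, ∀ y ∈ mMinus T i, ⁅i d, y⁆ ∈ mMinus T i) ∧
    (∀ x ∈ mPlus T i ⊔ LinearMap.range i.toLinearMap,
     ∀ y ∈ mPlus T i ⊔ LinearMap.range i.toLinearMap,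
      ⁅x, y⁆ ∈ mPlus T i ⊔ LinearMap.range i.toLinearMap) ∧
    (∀ x ∈ mMinus T i ⊔ LinearMap.range i.toLinearMap,
     ∀ y ∈ mMinus T i ⊔ LinearMap.range i.toLinearMap,
      ⁅x, y⁆ ∈ mMinus T i ⊔ LinearMap.range i.toLinearMap) := by
  have hp : ∀ d : gD, ∀ y ∈ mPlus T i, ⁅i d, y⁆ ∈ mPlus T i :=
    fun d _ hy => hi.lie_mem_mPlus hsplit.1 d hy
  have hq : ∀ d : gD, ∀ y ∈ mMinus T i, ⁅i d, y⁆ ∈ mMinus T i :=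
    fun d _ hy => hi.swap.lie_mem_mPlus hsplit.2 d hy
  exact ⟨hp, hq, lie_mem_sup_range i hsplit.1 hp, lie_mem_sup_range i hsplit.2 hq⟩

end ManinStmt
end

section
/- Let (h, (α_i)_{i∈I}, (h_i)_{i∈I}) be a realization of an n×n matrix A = (a_{ij})_{i,j∈I} over a field k of characteristic zero, and let J ⊆ I be a nonempty subset. Then: (1) the subspace h'_J ∩ t_J has dimension |J| − rank(A_J); (2) any complement h''_J of h'_J + t_J in h has dimension |J| − rank(A_J); (3) the sum h_J := h'_J + h''_J is direct and dim h_J = 2|J| − rank(A_J); and (4) the restrictions of the functionals (α_j)_{j∈J} to h_J are linearly independent. Consequently (h_J, (α_j|_{h_J})_{j∈J}, (h_j)_{j∈J}) is a realization of the submatrix A_J. -/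
namespace RealizationStmt

variable {k : Type*} [Field k] [CharZero k]
variable {I : Type*} [Fintype I] [DecidableEq I]
variable {h : Type*} [AddCommGroup h] [Module k h]

/-- `(h, α, Hv)` is a realization of the matrix `A`: `dim h = 2n − rank A`, the
families `α` (in `h*`) and `Hv` (in `h`) are linearly independent, and
`α i (Hv j) = A j i`. -/
def IsRealization (A : Matrix I I k) (α : I → (h →ₗ[k] k)) (Hv : I → h) : Prop :=
  Module.finrank k h = 2 * Fintype.card I - A.rank ∧
  LinearIndependent k α ∧ LinearIndependent k Hv ∧
  ∀ i j, α i (Hv j) = A j i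

/-- `h'_J = span { Hv j : j ∈ J }`. -/
def hspan (Hv : I → h) (J : Finset I) : Submodule k h :=
  Submodule.span k (Hv '' ↑J)

/-- `t_J = ⋂_{j ∈ J} ker (α j)`. -/
def tcap (α : I → (h →ₗ[k] k)) (J : Finset I) : Submodule k h :=
  ⨅ j ∈ J, LinearMap.ker (α j)

/-- The submatrix `A_J`. -/
def subMat (A : Matrix I I k) (J : Finset I) : Matrix ↥J ↥J k :=
  A.submatrix Subtype.val Subtype.val


omit [CharZero k] in
theorem finrank_map_add_finrank_inf_ker {V : Type*} [AddCommGroup V] [Module k V]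
    [FiniteDimensional k h] (f : h →ₗ[k] V) (p : Submodule k h) :
    Module.finrank k (p.map f) + Module.finrank k ↥(p ⊓ LinearMap.ker f) =
      Module.finrank k p := by
  rw [← LinearMap.finrank_range_add_finrank_ker (f.domRestrict p), LinearMap.range_domRestrict,
    LinearMap.ker_domRestrict, ← Submodule.map_comap_subtype, Submodule.finrank_map_subtype_eq]

omit [CharZero k] [Fintype I] [DecidableEq I] in
theorem finrank_hspan {Hv : I → h} (hHv : LinearIndependent k Hv) (J : Finset I) :
    Module.finrank k (hspan (k := k) Hv J) = J.card := by
  have hJ : LinearIndependent k (fun j : ↥J => Hv j) :=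
    hHv.comp _ Subtype.val_injective
  have := finrank_span_eq_card hJ
  rw [Fintype.card_coe] at this
  rw [← this, hspan, Set.image_eq_range]
  rfl

omit [CharZero k] [Fintype I] [DecidableEq I] in
theorem mem_tcap {α : I → (h →ₗ[k] k)} {J : Finset I} {x : h} :
    x ∈ tcap α J ↔ ∀ j ∈ J, α j x = 0 := by
  simp [tcap]

omit [CharZero k] [Fintype I] [DecidableEq I] in
theorem ker_pi_eq_tcap (α : I → (h →ₗ[k] k)) (J : Finset I) :
    LinearMap.ker (LinearMap.pi fun j : ↥J => α j) = tcap α J := by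
  ext x
  simp [mem_tcap, funext_iff]

omit [CharZero k] [Fintype I] [DecidableEq I] in
theorem finrank_tcap [FiniteDimensional k h] {α : I → (h →ₗ[k] k)}
    (hα : LinearIndependent k α) (J : Finset I) :
    J.card + Module.finrank k (tcap α J) = Module.finrank k h := by
  have h1 : tcap α J = (hspan α J).dualCoannihilator := by
    ext x
    rw [mem_tcap, hspan, ← SetLike.mem_coe, Submodule.coe_dualCoannihilator_span]
    simp
  rw [h1, ← finrank_hspan hα J]
  exact Subspace.finrank_add_finrank_dualCoannihilator_eq _

omit [CharZero k] [Fintype I] [DecidableEq I] in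
theorem finrank_map_pi_hspan {A : Matrix I I k} {α : I → (h →ₗ[k] k)} {Hv : I → h}
    (hA : ∀ i j, α i (Hv j) = A j i) (J : Finset I) :
    Module.finrank k ((hspan Hv J).map (LinearMap.pi fun j : ↥J => α j)) =
      (subMat A J).rank := by
  rw [Matrix.rank_eq_finrank_span_row, hspan, Submodule.map_span, Set.image_image,
    Set.image_eq_range]
  exact congrArg (fun v : ↥J → ↥J → k => Module.finrank k (Submodule.span k (Set.range v)))
    (funext₂ fun _ _ => hA _ _)

omit [CharZero k] [Fintype I] [DecidableEq I] in
theorem linearIndependent_domRestrict_of_sup_tcap_eq_top {α : I → (h →ₗ[k] k)}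
    (hα : LinearIndependent k α) {J : Finset I} {p : Submodule k h}
    (hp : p ⊔ tcap α J = ⊤) :
    LinearIndependent k (fun j : ↥J => (α j.1).domRestrict p) := by
  have hJ : LinearIndependent k (fun j : ↥J => α j) := hα.comp _ Subtype.val_injective
  rw [Fintype.linearIndependent_iff] at hJ ⊢
  intro c hc
  refine hJ c (LinearMap.ext fun x => ?_)
  obtain ⟨y, hy, z, hz, rfl⟩ := Submodule.mem_sup.1 (hp ▸ Submodule.mem_top : x ∈ p ⊔ tcap α J)
  have hcy := LinearMap.congr_fun hc ⟨y, hy⟩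
  have hz' (j : ↥J) : α j z = 0 := mem_tcap.1 hz j j.2
  simpa [hz'] using hcy

/-- for a realization of `A` and nonempty `J ⊆ I`:
`dim (h'_J ∩ t_J) = |J| − rank A_J`; any complement `h''_J` of `h'_J + t_J` has
dimension `|J| − rank A_J`; the sum `h_J = h'_J + h''_J` is direct of dimension
`2|J| − rank A_J`; the restrictions of the `α_j` (`j ∈ J`) to `h_J` are linearly
independent; and `Hv j ∈ h_J` for `j ∈ J`, so `(h_J, α|_J, Hv|_J)` is a
realization of `A_J`. -/
theorem realization_of_submatrix [FiniteDimensional k h]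
    (A : Matrix I I k) (α : I → (h →ₗ[k] k)) (Hv : I → h)
    (hreal : IsRealization A α Hv) (J : Finset I) (hJ : J.Nonempty) :
    Module.finrank k ↥(hspan Hv J ⊓ tcap α J) = J.card - (subMat A J).rank ∧
    ∀ hJ'' : Submodule k h, IsCompl hJ'' (hspan Hv J ⊔ tcap α J) →
      Module.finrank k ↥hJ'' = J.card - (subMat A J).rank ∧
      Disjoint (hspan Hv J) hJ'' ∧
      Module.finrank k ↥(hspan Hv J ⊔ hJ'') = 2 * J.card - (subMat A J).rank ∧
      LinearIndependent k (fun j : ↥J => (α j.1).domRestrict (hspan Hv J ⊔ hJ'')) ∧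
      ∀ j ∈ J, Hv j ∈ hspan Hv J ⊔ hJ'' := by
  obtain ⟨-, hα, hHv, hA⟩ := hreal
  have h1 := finrank_map_add_finrank_inf_ker (LinearMap.pi fun j : ↥J => α j) (hspan Hv J)
  rw [finrank_map_pi_hspan hA, ker_pi_eq_tcap, finrank_hspan hHv] at h1
  refine ⟨by lia, fun q hq => ?_⟩
  have h2 := finrank_tcap hα J
  have h3 := Submodule.finrank_sup_add_finrank_inf_eq (hspan Hv J) (tcap α J)
  rw [finrank_hspan hHv] at h3
  have h4 := Submodule.finrank_add_eq_of_isCompl hq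
  have hd : Disjoint (hspan Hv J) q := (hq.disjoint.mono_right le_sup_left).symm
  have h5 := Submodule.finrank_sup_add_finrank_inf_eq (hspan Hv J) q
  rw [hd.eq_bot, finrank_bot, finrank_hspan hHv] at h5
  refine ⟨by lia, hd, by lia, ?_, fun j hj => ?_⟩
  · refine linearIndependent_domRestrict_of_sup_tcap_eq_top hα ?_
    rw [sup_right_comm, sup_comm, hq.sup_eq_top]
  · exact Submodule.mem_sup_left (Submodule.subset_span (Set.mem_image_of_mem Hv hj))

end RealizationStmt
end

section
/- Let A = (a_{ij})_{i,j∈I} be a symmetrizable n×n matrix over a field k of characteristic zero, i.e. there exist nonzero scalars (d_i)_{i∈I} with d_i a_{ij} = d_j a_{ji} for all i, j. Let (h, (α_i), (h_i)) be a realization of A and let (·|·) be a nondegenerate symmetric bilinear form on h satisfying (h | h_i) = d_i^{-1} α_i(h) for all h ∈ h and i ∈ I. Then for every nonempty subset J ⊆ I, every choice of complement h''_J of h'_J + t_J in h, and h_J := h'_J ⊕ h''_J, the restriction of (·|·) to h_J is nondegenerate. -/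
namespace RealizationStmt

variable {k : Type*} [Field k] [CharZero k]
variable {I : Type*} [Fintype I] [DecidableEq I]
variable {h : Type*} [AddCommGroup h] [Module k h]

/-- if `A` is symmetrizable (`d i * A i j = d j * A j i`, `d i ≠ 0`)
and `B` is a nondegenerate symmetric bilinear form on `h` with
`B x (Hv i) = (d i)⁻¹ • α i x`, then for every nonempty `J` and every choice of
complement `h''_J` of `h'_J + t_J`, the restriction of `B` to `h_J = h'_J ⊔ h''_J`
is nondegenerate. -/
theorem restricted_form_nondegenerate [FiniteDimensional k h]
    (A : Matrix I I k) (d : I → k) (hd : ∀ i, d i ≠ 0)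
    (hsymA : ∀ i j, d i * A i j = d j * A j i)
    (α : I → (h →ₗ[k] k)) (Hv : I → h) (hreal : IsRealization A α Hv)
    (B : h →ₗ[k] h →ₗ[k] k)
    (hBsymm : ∀ x y, B x y = B y x)
    (hBnondeg : ∀ x : h, (∀ y : h, B x y = 0) → x = 0)
    (hBH : ∀ (x : h) (i : I), B x (Hv i) = (d i)⁻¹ * α i x)
    (J : Finset I) (hJ : J.Nonempty)
    (hJ'' : Submodule k h) (hcompl : IsCompl hJ'' (hspan Hv J ⊔ tcap α J)) :
    ∀ x ∈ hspan Hv J ⊔ hJ'', (∀ y ∈ hspan Hv J ⊔ hJ'', B x y = 0) → x = 0 := by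
  have mem_tcap : ∀ x : h, (∀ y ∈ hspan (k := k) Hv J, B x y = 0) → x ∈ tcap α J := by
    intro x hx
    simp only [tcap, Submodule.mem_iInf, LinearMap.mem_ker]
    intro j hj
    have h0 := hx (Hv j) (Submodule.subset_span ⟨j, hj, rfl⟩)
    rw [hBH] at h0
    exact (mul_eq_zero.mp h0).resolve_left (inv_ne_zero (hd j))
  have tcap_orth : ∀ x ∈ tcap α J, ∀ y ∈ hspan (k := k) Hv J, B x y = 0 := by
    intro x hx y hy
    simp only [tcap, Submodule.mem_iInf, LinearMap.mem_ker] at hx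
    have hle : hspan (k := k) Hv J ≤ LinearMap.ker (B x) := by
      refine Submodule.span_le.mpr ?_
      rintro _ ⟨j, hj, rfl⟩
      simp [hBH, hx j hj]
    exact hle hy
  intro x hx hxorth
  have hxt : x ∈ tcap α J :=
    mem_tcap x fun y hy => hxorth y (Submodule.mem_sup_left hy)
  obtain ⟨w, hw, u, hu, rfl⟩ := Submodule.mem_sup.mp hx
  have hu' : u ∈ hspan (k := k) Hv J ⊔ tcap α J := by
    have hsub := Submodule.sub_mem _ (Submodule.mem_sup_right (S := hspan (k := k) Hv J) hxt)
      (Submodule.mem_sup_left hw)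
    simpa using hsub
  obtain rfl : u = 0 := Submodule.disjoint_def.mp hcompl.disjoint u hu hu'
  rw [add_zero] at *
  refine hBnondeg w fun y => ?_
  have hy : y ∈ hJ'' ⊔ (hspan (k := k) Hv J ⊔ tcap α J) := by
    rw [hcompl.sup_eq_top]
    exact Submodule.mem_top
  obtain ⟨a, ha, b, hb, rfl⟩ := Submodule.mem_sup.mp hy
  obtain ⟨c, hc, e, he, rfl⟩ := Submodule.mem_sup.mp hb
  rw [map_add, map_add, hxorth a (Submodule.mem_sup_right ha), tcap_orth w hxt c hc,
    hBsymm w e, tcap_orth e he w hw]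
  simp

end RealizationStmt
end

section
/- Let A be the symmetric 4×4 matrix with rows (2,−1,0,0), (−1,2,−2,0), (0,−2,2,−1), (0,0,−1,2) over a field k of characteristic zero, and let (h, (α_i), (h_i)) be any realization of A (so dim h = 4, since A is invertible). Then there is no choice of subspaces h''_J (a complement of h'_J + t_J in h) for every nonempty J ⊆ {1,2,3,4} such that the subspaces h_J := h'_J ⊕ h''_J satisfy h_J ⊆ h_{J′} whenever J ⊆ J′. (Indeed, dim h_{{2,3}} = 3 while h_{{1,2,3}} ∩ h_{{2,3,4}} = span{h₂, h₃} has dimension 2.) -/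
namespace RealizationStmt

variable {k : Type*} [Field k] [CharZero k]
variable {I : Type*} [Fintype I] [DecidableEq I]
variable {h : Type*} [AddCommGroup h] [Module k h]

/-- Three coroots whose Cartan submatrix is `(2,−1,0), (−1,2,−2), (0,−2,2)`, of determinant `−2`,
span a complement of the common kernel of their roots. -/
lemma hspan_sup_tcap_eq_top (α : Fin 4 → (h →ₗ[k] k)) (Hv : Fin 4 → h) (p q r : Fin 4)
    (hpp : α p (Hv p) = 2) (hpq : α p (Hv q) = -1) (hpr : α p (Hv r) = 0)
    (hqp : α q (Hv p) = -1) (hqq : α q (Hv q) = 2) (hqr : α q (Hv r) = -2)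
    (hrp : α r (Hv p) = 0) (hrq : α r (Hv q) = -2) (hrr : α r (Hv r) = 2) :
    hspan Hv {p, q, r} ⊔ tcap α {p, q, r} = ⊤ := by
  refine eq_top_iff.2 fun x _ ↦ ?_
  have hmem : ∀ j ∈ ({p, q, r} : Finset (Fin 4)), Hv j ∈ hspan (k := k) Hv {p, q, r} :=
    fun j hj ↦ Submodule.subset_span ⟨j, hj, rfl⟩
  let y : h := (-α q x - α r x) • Hv p + (-α p x - 2 * α q x - 2 * α r x) • Hv q +
    (-α p x - 2 * α q x - 3 / 2 * α r x) • Hv r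
  refine Submodule.mem_sup.2 ⟨y, ?_, x - y, ?_, by abel⟩
  · exact add_mem (add_mem (Submodule.smul_mem _ _ (hmem p (by simp)))
      (Submodule.smul_mem _ _ (hmem q (by simp)))) (Submodule.smul_mem _ _ (hmem r (by simp)))
  · simp only [tcap, Submodule.mem_iInf, Finset.mem_insert, Finset.mem_singleton,
      LinearMap.mem_ker]
    rintro j (rfl | rfl | rfl)
    · simp only [y, map_sub, map_add, map_smul, smul_eq_mul, hpp, hpq, hpr]
      ring
    · simp only [y, map_sub, map_add, map_smul, smul_eq_mul, hqp, hqq, hqr]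
      ring
    · simp only [y, map_sub, map_add, map_smul, smul_eq_mul, hrp, hrq, hrr]
      ring

/-- For linearly independent coroots, `h'_J ∩ h'_K = h'_{J ∩ K}`. -/
lemma hspan_inf_hspan {Hv : I → h} (hli : LinearIndependent k Hv) (J K : Finset I) :
    hspan (k := k) Hv J ⊓ hspan Hv K ≤ hspan Hv (J ∩ K) := by
  rintro x ⟨hJ, hK⟩
  obtain ⟨f, hf, rfl⟩ := (Finsupp.mem_span_image_iff_linearCombination k).1 hJ
  obtain ⟨g, hg, hgf⟩ := (Finsupp.mem_span_image_iff_linearCombination k).1 hK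
  obtain rfl : g = f := hli hgf
  refine (Finsupp.mem_span_image_iff_linearCombination k).2 ⟨g, ?_, rfl⟩
  rw [Finset.coe_inter]
  exact (Finsupp.mem_supported k g).2
    (Set.subset_inter ((Finsupp.mem_supported k g).1 hf) ((Finsupp.mem_supported k g).1 hg))

/-- for the matrix with rows `(2,−1,0,0), (−1,2,−2,0), (0,−2,2,−1),
(0,0,−1,2)`, no realization admits a monotone diagrammatic choice of the
subspaces `h_J = h'_J ⊕ h''_J`. -/
theorem no_diagrammatic_structure [FiniteDimensional k h]
    (α : Fin 4 → (h →ₗ[k] k)) (Hv : Fin 4 → h)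
    (hreal : IsRealization
      (!![(2 : k), -1, 0, 0; -1, 2, -2, 0; 0, -2, 2, -1; 0, 0, -1, 2]) α Hv) :
    ¬ ∃ c : Finset (Fin 4) → Submodule k h,
        (∀ J : Finset (Fin 4), J.Nonempty →
          IsCompl (c J) (hspan Hv J ⊔ tcap α J)) ∧
        (∀ J J' : Finset (Fin 4), J.Nonempty → J ⊆ J' →
          hspan Hv J ⊔ c J ≤ hspan Hv J' ⊔ c J') := by
  obtain ⟨-, -, hli, hα⟩ := hreal
  rintro ⟨c, hc, hmono⟩
  have hbot : ∀ J : Finset (Fin 4), J.Nonempty → hspan Hv J ⊔ tcap α J = ⊤ → c J = ⊥ :=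
    fun J hJ htop ↦ by simpa [htop] using (hc J hJ).disjoint
  have h012 : c {0, 1, 2} = ⊥ := hbot _ (by simp) <| by
    apply hspan_sup_tcap_eq_top <;> simp [hα]
  have h321 : c {3, 2, 1} = ⊥ := hbot _ (by simp) <| by
    apply hspan_sup_tcap_eq_top <;> simp [hα]
  have hle : c {1, 2} ≤ hspan Hv {1, 2} := by
    have h₁ := hmono {1, 2} {0, 1, 2} (by simp) (by decide)
    have h₂ := hmono {1, 2} {3, 2, 1} (by simp) (by decide)
    rw [h012, sup_bot_eq] at h₁
    rw [h321, sup_bot_eq] at h₂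
    have hinter : ({0, 1, 2} ∩ {3, 2, 1} : Finset (Fin 4)) = {1, 2} := by decide
    have h₃ := hspan_inf_hspan hli {0, 1, 2} {3, 2, 1}
    rw [hinter] at h₃
    exact (le_inf (le_sup_right.trans h₁) (le_sup_right.trans h₂)).trans h₃
  have hcompl := hc {1, 2} (by simp)
  have htop : hspan Hv {1, 2} ⊔ tcap α {1, 2} = ⊤ := by
    rw [← hcompl.sup_eq_top]
    exact (sup_eq_right.2 (hle.trans le_sup_left)).symm
  have hker : hspan Hv {1, 2} ⊔ tcap α {1, 2} ≤ LinearMap.ker (α 1 + α 2) := by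
    refine sup_le (Submodule.span_le.2 ?_) fun x hx ↦ ?_
    · rintro _ ⟨j, hj, rfl⟩
      obtain rfl | rfl : j = 1 ∨ j = 2 := by simpa using hj
      · simp [hα]
      · simp [hα]
    · simp only [tcap, Submodule.mem_iInf, LinearMap.mem_ker] at hx
      simp [hx 1 (by simp), hx 2 (by simp)]
  have hzero : Hv 0 ∈ LinearMap.ker (α 1 + α 2) := hker (htop ▸ Submodule.mem_top)
  simp [hα] at hzero

end RealizationStmt
end
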